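/- Let λ, λ₁, λ₂ ∈ ℝ with λ₁ + λ₂ = λ, let 0 < θ < 1, and let Φ(t) = t^p (log(e+t))^{λ₁} where either p > 1 and λ₁ ∈ ℝ, or p = 1 and λ₁ ≥ 0. Then the sets {f ∈ L^Φ(ν) : ‖f‖_{Ḃ^{θ,λ}_p} < ∞} and {f ∈ L^Φ(ν) : inf{k > 0 : |f/k|_{Ḃ^{θ,λ₂}_Φ} ≤ 1} < ∞} coincide, and there is a constant C ≥ 1 such that for every f in this common set, C⁻¹·(‖f‖_{L^Φ(ν)} + ‖f‖_{Ḃ^{θ,λ}_p}) ≤ ‖f‖_{L^Φ(ν)} + inf{k > 0 : |f/k|_{Ḃ^{θ,λ₂}_Φ} ≤ 1} ≤ C·(‖f‖_{L^Φ(ν)} + ‖f‖_{Ḃ^{θ,λ}_p}). -/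

import Mathlib

open MeasureTheory ENNReal NNReal

noncomputable section

abbrev Bd (K : ℕ) := ℕ → Fin K

def cyl {K n : ℕ} (w : Fin n → Fin K) : Set (Bd K) := {ξ | ∀ i : Fin n, ξ i = w i}

noncomputable def cylAvg {K : ℕ} (ν : Measure (Bd K)) (f : Bd K → ℝ) {n : ℕ}
    (w : Fin n → Fin K) : ℝ :=
  (ν (cyl w)).toReal⁻¹ * ∫ x in cyl w, f x ∂ν

noncomputable def besovEnergy {K : ℕ} (ν : Measure (Bd K)) (ε θ p lam : ℝ)
    (f : Bd K → ℝ) : ℝ≥0∞ :=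
  ∑' n : ℕ, ENNReal.ofReal (Real.exp (ε * ((n : ℝ) + 1) * θ * p) * ((n : ℝ) + 1) ^ lam *
    ∑ w : Fin (n + 1) → Fin K,
      (ν (cyl w)).toReal * |cylAvg ν f w - cylAvg ν f (Fin.init w)| ^ p)

noncomputable def orliczEnergy {K : ℕ} (ν : Measure (Bd K)) (Φ : ℝ → ℝ) (ε θ p lam2 : ℝ)
    (f : Bd K → ℝ) : ℝ≥0∞ :=
  ∑' n : ℕ, ENNReal.ofReal (Real.exp (ε * ((n : ℝ) + 1) * (θ - 1) * p) * ((n : ℝ) + 1) ^ lam2 *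
    ∑ w : Fin (n + 1) → Fin K,
      (ν (cyl w)).toReal *
        Φ (Real.exp (ε * ((n : ℝ) + 1)) * |cylAvg ν f w - cylAvg ν f (Fin.init w)|))

noncomputable def Phi (p lam1 : ℝ) (t : ℝ) : ℝ := t ^ p * Real.log (Real.exp 1 + t) ^ lam1

noncomputable def luxNorm {α : Type*} [MeasurableSpace α] (μ : Measure α) (Φ : ℝ → ℝ)
    (u : α → ℝ) : ℝ≥0∞ :=
  ⨅ (k : ℝ≥0) (_ : 0 < k) (_ : ∫⁻ x, ENNReal.ofReal (Φ (|u x| / k)) ∂μ ≤ 1), (k : ℝ≥0∞)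

def MemLPhi {α : Type*} [MeasurableSpace α] (μ : Measure α) (Φ : ℝ → ℝ) (u : α → ℝ) : Prop :=
  AEStronglyMeasurable u μ ∧ ∃ α₀ : ℝ, 0 < α₀ ∧ ∫⁻ x, ENNReal.ofReal (Φ (α₀ * |u x|)) ∂μ < ⊤

noncomputable def orliczSemi {K : ℕ} (ν : Measure (Bd K)) (Φ : ℝ → ℝ) (ε θ p lam2 : ℝ)
    (f : Bd K → ℝ) : ℝ≥0∞ :=
  ⨅ (k : ℝ≥0) (_ : 0 < k)
    (_ : orliczEnergy ν Φ ε θ p lam2 (fun x => f x / k) ≤ 1), (k : ℝ≥0∞)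

end

open MeasureTheory ENNReal NNReal

lemma rpow_le_rpow_abs_mul {c u v : ℝ} (hc : 1 ≤ c) (hu : 0 < u) (hv : 0 < v)
    (huv : u ≤ c * v) (hvu : v ≤ c * u) (l : ℝ) : u ^ l ≤ c ^ |l| * v ^ l := by
  have hc0 : 0 < c := by linarith
  rcases le_total 0 l with hl | hl
  · rw [abs_of_nonneg hl, ← Real.mul_rpow hc0.le hv.le]
    exact Real.rpow_le_rpow hu.le huv hl
  · have h : (c * u) ^ l ≤ v ^ l := Real.rpow_le_rpow_of_nonpos hv hvu hl
    rw [Real.mul_rpow hc0.le hu.le] at h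
    calc u ^ l = c ^ |l| * (c ^ l * u ^ l) := by
          rw [abs_of_nonpos hl, Real.rpow_neg hc0.le, ← mul_assoc, inv_mul_cancel₀, one_mul]
          exact (Real.rpow_pos_of_pos hc0 l).ne'
      _ ≤ c ^ |l| * v ^ l := by gcongr

lemma one_le_log_exp_one_add {t : ℝ} (ht : 0 ≤ t) : 1 ≤ Real.log (Real.exp 1 + t) := by
  rw [Real.le_log_iff_exp_le (by positivity)]
  linarith

lemma Phi_nonneg (p l : ℝ) {t : ℝ} (ht : 0 ≤ t) : 0 ≤ Phi p l t :=
  mul_nonneg (Real.rpow_nonneg ht _)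
    (Real.rpow_nonneg (zero_le_one.trans (one_le_log_exp_one_add ht)) _)

/-- A quantity growing at most logarithmically has powers growing slower than any power. -/
lemma rpow_abs_le_of_le_add_log (a l : ℝ) {η : ℝ} (ha : 0 ≤ a) (hη : 0 < η) :
    ∃ B : ℝ, 1 ≤ B ∧ ∀ s c : ℝ, 1 ≤ s → 0 ≤ c → c ≤ a + Real.log s →
      c ^ |l| ≤ B * s ^ η := by
  set ζ := η / (|l| + 1) with hζ
  have hl : 0 < |l| + 1 := by positivity
  have hζ0 : 0 < ζ := by positivity
  have hb : 1 ≤ 1 + a + 1 / ζ := by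
    have : 0 ≤ 1 / ζ := by positivity
    linarith
  refine ⟨(1 + a + 1 / ζ) ^ |l|, Real.one_le_rpow hb (abs_nonneg l), fun s c hs hc hcs => ?_⟩
  have hs0 : 0 < s := by linarith
  have h1 : 1 ≤ s ^ ζ := Real.one_le_rpow hs hζ0.le
  have h2 : c ≤ (1 + a + 1 / ζ) * s ^ ζ := by
    have := Real.log_le_rpow_div hs0.le hζ0
    have h3 : a ≤ a * s ^ ζ := le_mul_of_one_le_right ha h1
    calc c ≤ a * s ^ ζ + s ^ ζ / ζ := by linarith
      _ ≤ 1 * s ^ ζ + (a * s ^ ζ + s ^ ζ / ζ) := by linarith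
      _ = _ := by ring
  calc c ^ |l| ≤ ((1 + a + 1 / ζ) * s ^ ζ) ^ |l| := Real.rpow_le_rpow hc h2 (abs_nonneg l)
    _ = (1 + a + 1 / ζ) ^ |l| * s ^ (ζ * |l|) := by
        rw [Real.mul_rpow (by linarith) (by linarith), ← Real.rpow_mul hs0.le]
    _ ≤ (1 + a + 1 / ζ) ^ |l| * s ^ η := by
        gcongr
        rw [hζ, div_mul_eq_mul_div, div_le_iff₀ hl]
        nlinarith

lemma exists_Phi_div_le {p : ℝ} (hp : 1 ≤ p) (l : ℝ) :
    ∃ B : ℝ, 1 ≤ B ∧ ∀ s t : ℝ, 1 ≤ s → 0 ≤ t →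
      Phi p l (t / s) ≤ B * s ^ (-(1 / 2) : ℝ) * Phi p l t := by
  obtain ⟨B, hB, h⟩ := rpow_abs_le_of_le_add_log 1 l zero_le_one (one_half_pos (α := ℝ))
  refine ⟨B, hB, fun s t hs ht => ?_⟩
  have hs0 : 0 < s := by linarith
  have hls := Real.log_nonneg hs
  have hts : 0 ≤ t / s := by positivity
  have hL := one_le_log_exp_one_add ht
  have hL' := one_le_log_exp_one_add hts
  have hle : t / s ≤ t := div_le_self ht hs
  have hlog : Real.log (Real.exp 1 + t / s) ≤ Real.log (Real.exp 1 + t) :=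
    Real.log_le_log (by positivity) (by linarith)
  have hlog' : Real.log (Real.exp 1 + t) ≤ Real.log s + Real.log (Real.exp 1 + t / s) := by
    rw [← Real.log_mul hs0.ne' (by positivity)]
    refine Real.log_le_log (by positivity) ?_
    rw [mul_add, mul_div_cancel₀ _ hs0.ne']
    nlinarith [Real.exp_pos 1]
  have hr := rpow_le_rpow_abs_mul (c := 1 + Real.log s) (by linarith)
    (by linarith) (by linarith : 0 < Real.log (Real.exp 1 + t)) (by nlinarith) (by nlinarith) l
  have hc := h s _ hs (by linarith) le_rfl
  have hpow : s ^ (-p) ≤ s ^ (-1 : ℝ) := Real.rpow_le_rpow_of_exponent_le hs (by linarith)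
  have hLl : 0 ≤ Real.log (Real.exp 1 + t) ^ l := Real.rpow_nonneg (by linarith) _
  unfold Phi
  calc (t / s) ^ p * Real.log (Real.exp 1 + t / s) ^ l
      ≤ (t ^ p * s ^ (-1 : ℝ)) * ((B * s ^ (1 / 2 : ℝ)) * Real.log (Real.exp 1 + t) ^ l) := by
        apply mul_le_mul
        · rw [Real.div_rpow ht hs0.le, div_eq_mul_inv, ← Real.rpow_neg hs0.le]
          gcongr
        · exact hr.trans (by gcongr)
        · exact Real.rpow_nonneg (by linarith) _
        · positivity
    _ = B * (s ^ (-1 : ℝ) * s ^ (1 / 2 : ℝ)) * (t ^ p * Real.log (Real.exp 1 + t) ^ l) := by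
        ring
    _ = _ := by
        rw [← Real.rpow_add hs0]
        norm_num

lemma exists_le_one_add_Phi {p l : ℝ} (hp : 1 < p ∨ (p = 1 ∧ 0 ≤ l)) :
    ∃ C : ℝ, 1 ≤ C ∧ ∀ t : ℝ, 0 ≤ t → t ≤ 1 + C * Phi p l t := by
  suffices h : ∃ C : ℝ, 1 ≤ C ∧ ∀ t : ℝ, 1 ≤ t →
      1 ≤ C * (t ^ (p - 1) * Real.log (Real.exp 1 + t) ^ l) by
    obtain ⟨C, hC, h⟩ := h
    refine ⟨C, hC, fun t ht => ?_⟩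
    have hP := Phi_nonneg p l ht
    rcases le_total t 1 with h1 | h1
    · nlinarith
    · have h2 := mul_le_mul_of_nonneg_left (h t h1) ht
      have h3 : t ^ p = t * t ^ (p - 1) := by
        rw [Real.rpow_sub_one (by linarith)]
        field_simp
      unfold Phi
      rw [h3]
      nlinarith
  rcases le_or_gt 0 l with hl | hl
  · refine ⟨1, le_rfl, fun t ht => ?_⟩
    rw [one_mul]
    refine one_le_mul_of_one_le_of_one_le (Real.one_le_rpow ht ?_)
      (Real.one_le_rpow (one_le_log_exp_one_add (by linarith)) hl)
    rcases hp with hp | hp <;> linarith [hp]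
  · have hp1 : 0 < p - 1 := by
      rcases hp with hp | hp
      · linarith
      · linarith [hp.2]
    obtain ⟨B, hB, h⟩ := rpow_abs_le_of_le_add_log 2 l zero_le_two hp1
    refine ⟨B, hB, fun t ht => ?_⟩
    have hL := one_le_log_exp_one_add (zero_le_one.trans ht)
    have hlog : Real.log (Real.exp 1 + t) ≤ 2 + Real.log t := by
      have he : Real.exp 2 = Real.exp 1 * Real.exp 1 := by rw [← Real.exp_add]; norm_num
      have h2 : 2 ≤ Real.exp 1 := by linarith [Real.add_one_le_exp (1 : ℝ)]
      rw [← Real.log_exp 2, ← Real.log_mul (Real.exp_pos 2).ne' (by linarith), he]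
      refine Real.log_le_log (by positivity) ?_
      nlinarith [mul_le_mul h2 ht zero_le_one (Real.exp_pos 1).le]
    have h3 := h t _ ht (by linarith) hlog
    have h4 : 0 < Real.log (Real.exp 1 + t) ^ l := Real.rpow_pos_of_pos (by linarith) _
    calc 1 = Real.log (Real.exp 1 + t) ^ |l| * Real.log (Real.exp 1 + t) ^ l := by
          rw [abs_of_neg hl, Real.rpow_neg (by linarith), inv_mul_cancel₀ h4.ne']
      _ ≤ B * t ^ (p - 1) * Real.log (Real.exp 1 + t) ^ l := by gcongr
      _ = _ := by ring

lemma lintegral_ofReal_abs_div_le {α : Type*} [MeasurableSpace α] {μ : Measure α}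
    [IsProbabilityMeasure μ] {Φ : ℝ → ℝ} {C : ℝ} (hC : 0 ≤ C)
    (hΦ : ∀ t, 0 ≤ t → t ≤ 1 + C * Φ t) (hΦ0 : ∀ t, 0 ≤ t → 0 ≤ Φ t) {u : α → ℝ} {M : ℝ≥0}
    (hM : luxNorm μ Φ u < M) :
    ∫⁻ x, ‖u x / M‖ₑ ∂μ ≤ ENNReal.ofReal (1 + C) := by
  unfold luxNorm at hM
  simp only [iInf_lt_iff] at hM
  obtain ⟨k, hk, hint, hkM⟩ := hM
  have hkM' : k < M := by exact_mod_cast hkM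
  calc ∫⁻ x, ‖u x / M‖ₑ ∂μ
      ≤ ∫⁻ x, (1 + ENNReal.ofReal C * ENNReal.ofReal (Φ (|u x| / k))) ∂μ := by
        refine lintegral_mono fun x => ?_
        have h0 : 0 ≤ |u x| / (k : ℝ) := by positivity
        rw [← ENNReal.ofReal_mul hC, ← ENNReal.ofReal_one,
          ← ENNReal.ofReal_add zero_le_one (mul_nonneg hC (hΦ0 _ h0)), ← ofReal_norm]
        refine ENNReal.ofReal_le_ofReal (le_trans ?_ (hΦ _ h0))
        rw [Real.norm_eq_abs, abs_div, abs_of_nonneg M.coe_nonneg]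
        have : (0 : ℝ) < k := hk
        gcongr
    _ = 1 + ENNReal.ofReal C * ∫⁻ x, ENNReal.ofReal (Φ (|u x| / k)) ∂μ := by
        rw [lintegral_add_left measurable_const, lintegral_const_mul' _ _ ENNReal.ofReal_ne_top]
        simp
    _ ≤ 1 + ENNReal.ofReal C * 1 := by gcongr
    _ = ENNReal.ofReal (1 + C) := by
        rw [ENNReal.ofReal_add zero_le_one hC, mul_one, ENNReal.ofReal_one]

/-- For `s` large, `B s^{-1/2}` beats any finite constant. -/
lemma exists_one_le_mul_rpow_neg_half_le_one {B : ℝ} (A : ℝ≥0∞) (hB : 0 ≤ B) (hA : A ≠ ⊤) :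
    ∃ s : ℝ≥0, 1 ≤ s ∧ ENNReal.ofReal (B * (s : ℝ) ^ (-(1 / 2) : ℝ)) * A ≤ 1 := by
  lift A to ℝ≥0 using hA
  set a : ℝ := (A : ℝ)
  have ha : 0 ≤ a := A.coe_nonneg
  have h1 : 1 ≤ 1 + B * a := by nlinarith
  refine ⟨Real.toNNReal ((1 + B * a) ^ (2 : ℝ)), ?_, ?_⟩
  · exact Real.one_le_toNNReal.2 (Real.one_le_rpow h1 zero_le_two)
  · rw [← ENNReal.ofReal_coe_nnreal, ← ENNReal.ofReal_mul (by positivity)]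
    refine ENNReal.ofReal_le_one.2 ?_
    rw [Real.coe_toNNReal _ (by positivity), ← Real.rpow_mul (by linarith)]
    norm_num
    rw [Real.rpow_neg_one, mul_assoc, mul_comm _ (A : ℝ), ← mul_assoc, ← div_eq_mul_inv]
    exact div_le_one_of_le₀ (by linarith) (by linarith)

lemma luxNorm_lt_top_of_memLPhi {α : Type*} [MeasurableSpace α] {μ : Measure α}
    {p : ℝ} (hp : 1 ≤ p) {l : ℝ} {u : α → ℝ} (hu : MemLPhi μ (Phi p l) u) :
    luxNorm μ (Phi p l) u < ⊤ := by
  obtain ⟨-, a, ha, hint⟩ := hu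
  obtain ⟨B, hB, hdiv⟩ := exists_Phi_div_le hp l
  have hB0 : 0 ≤ B := by linarith
  obtain ⟨s, hs, hs1⟩ := exists_one_le_mul_rpow_neg_half_le_one _ hB0 hint.ne
  have hs0 : 0 < s := by positivity
  set k : ℝ≥0 := s / a.toNNReal with hk
  have hk0 : 0 < k := div_pos hs0 (Real.toNNReal_pos.2 ha)
  refine lt_of_le_of_lt (iInf₂_le_of_le k hk0 (iInf_le_of_le ?_ le_rfl)) ENNReal.coe_lt_top
  calc ∫⁻ x, ENNReal.ofReal (Phi p l (|u x| / k)) ∂μ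
      ≤ ∫⁻ x, ENNReal.ofReal (B * (s : ℝ) ^ (-(1 / 2) : ℝ)) *
          ENNReal.ofReal (Phi p l (a * |u x|)) ∂μ := by
        refine lintegral_mono fun x => ?_
        rw [← ENNReal.ofReal_mul (by positivity)]
        refine ENNReal.ofReal_le_ofReal ?_
        have h : |u x| / (k : ℝ) = a * |u x| / s := by
          rw [hk, NNReal.coe_div, Real.coe_toNNReal a ha.le]
          field_simp
        rw [h]
        exact hdiv _ _ (by exact_mod_cast hs) (by positivity)
    _ ≤ 1 := by rwa [lintegral_const_mul' _ _ ENNReal.ofReal_ne_top]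

section Cylinders

variable {K : ℕ} {ν : Measure (Bd K)}

lemma cylAvg_div (f : Bd K → ℝ) (k : ℝ) {n : ℕ} (w : Fin n → Fin K) :
    cylAvg ν (fun x => f x / k) w = cylAvg ν f w / k := by
  unfold cylAvg
  rw [integral_div, mul_div_assoc]

lemma abs_cylAvg_sub_div (f : Bd K → ℝ) {k : ℝ} (hk : 0 ≤ k) {n m : ℕ} (w : Fin n → Fin K)
    (v : Fin m → Fin K) :
    |cylAvg ν (fun x => f x / k) w - cylAvg ν (fun x => f x / k) v| =
      |cylAvg ν f w - cylAvg ν f v| / k := by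
  rw [cylAvg_div, cylAvg_div, ← _root_.sub_div, abs_div, abs_of_nonneg hk]

lemma measure_cyl_toReal (hν : ∀ (n : ℕ) (w : Fin n → Fin K), ν (cyl w) = ((K : ℝ≥0∞) ^ n)⁻¹)
    {n : ℕ} (w : Fin n → Fin K) : (ν (cyl w)).toReal = ((K : ℝ) ^ n)⁻¹ := by
  simp [hν]

lemma sum_measure_cyl (hK : K ≠ 0)
    (hν : ∀ (n : ℕ) (w : Fin n → Fin K), ν (cyl w) = ((K : ℝ≥0∞) ^ n)⁻¹) (n : ℕ) :
    ∑ w : Fin n → Fin K, (ν (cyl w)).toReal = 1 := by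
  simp only [measure_cyl_toReal hν, Finset.sum_const, Finset.card_univ, Fintype.card_fun,
    Fintype.card_fin, nsmul_eq_mul, Nat.cast_pow]
  exact mul_inv_cancel₀ (pow_ne_zero _ (Nat.cast_ne_zero.2 hK))

lemma abs_cylAvg_le (hν : ∀ (n : ℕ) (w : Fin n → Fin K), ν (cyl w) = ((K : ℝ≥0∞) ^ n)⁻¹)
    {f : Bd K → ℝ} {D : ℝ} (hD : 0 ≤ D) (hf : ∫⁻ x, ‖f x‖ₑ ∂ν ≤ ENNReal.ofReal D)
    {n : ℕ} (w : Fin n → Fin K) : |cylAvg ν f w| ≤ (K : ℝ) ^ n * D := by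
  have h : |∫ x in cyl w, f x ∂ν| ≤ D := by
    rw [← ENNReal.ofReal_le_ofReal_iff hD, ← Real.norm_eq_abs, ofReal_norm]
    exact (enorm_integral_le_lintegral_enorm _).trans ((setLIntegral_le_lintegral _ _).trans hf)
  unfold cylAvg
  rw [measure_cyl_toReal hν, inv_inv, abs_mul, abs_of_nonneg (by positivity)]
  gcongr

lemma abs_cylAvg_sub_init_le (hK : 1 ≤ K)
    (hν : ∀ (n : ℕ) (w : Fin n → Fin K), ν (cyl w) = ((K : ℝ≥0∞) ^ n)⁻¹)
    {f : Bd K → ℝ} {D : ℝ} (hD : 0 ≤ D) (hf : ∫⁻ x, ‖f x‖ₑ ∂ν ≤ ENNReal.ofReal D)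
    {n : ℕ} (w : Fin (n + 1) → Fin K) :
    |cylAvg ν f w - cylAvg ν f (Fin.init w)| ≤ 2 * D * (K : ℝ) ^ ((n : ℝ) + 1) := by
  have h1 := abs_cylAvg_le hν hD hf w
  have h2 := abs_cylAvg_le hν hD hf (Fin.init w)
  have hK' : (1 : ℝ) ≤ K := by exact_mod_cast hK
  have h3 : (K : ℝ) ^ n * D ≤ (K : ℝ) ^ (n + 1) * D := by
    exact mul_le_mul_of_nonneg_right (pow_le_pow_right₀ hK' n.le_succ) hD
  have h4 : (K : ℝ) ^ ((n : ℝ) + 1) = (K : ℝ) ^ (n + 1) := by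
    rw [← Real.rpow_natCast]
    norm_cast
  rw [h4]
  linarith [abs_sub (cylAvg ν f w) (cylAvg ν f (Fin.init w))]

lemma besovEnergy_div (ε θ lam : ℝ) {p : ℝ} (f : Bd K → ℝ) {k : ℝ} (hk : 0 < k) :
    besovEnergy ν ε θ p lam (fun x => f x / k) =
      ENNReal.ofReal (k ^ (-p)) * besovEnergy ν ε θ p lam f := by
  unfold besovEnergy
  rw [← ENNReal.tsum_mul_left]
  refine tsum_congr fun n => ?_
  rw [← ENNReal.ofReal_mul (by positivity)]
  congr 1
  simp only [abs_cylAvg_sub_div f hk.le, Real.div_rpow (abs_nonneg _) hk.le, Finset.mul_sum]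
  refine Finset.sum_congr rfl fun w _ => ?_
  rw [Real.rpow_neg hk.le]
  ring

lemma orliczEnergy_div_le {Φ : ℝ → ℝ} (ε θ p lam2 : ℝ) {s c : ℝ} (hs : 0 ≤ s) (hc : 0 ≤ c)
    (hΦ : ∀ t, 0 ≤ t → Φ (t / s) ≤ c * Φ t) (f : Bd K → ℝ) :
    orliczEnergy ν Φ ε θ p lam2 (fun x => f x / s) ≤
      ENNReal.ofReal c * orliczEnergy ν Φ ε θ p lam2 f := by
  unfold orliczEnergy
  rw [← ENNReal.tsum_mul_left]
  refine ENNReal.tsum_le_tsum fun n => ?_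
  rw [← ENNReal.ofReal_mul hc]
  refine ENNReal.ofReal_le_ofReal ?_
  rw [mul_left_comm c, Finset.mul_sum _ _ c]
  refine mul_le_mul_of_nonneg_left (Finset.sum_le_sum fun w _ => ?_) (by positivity)
  rw [mul_left_comm c, abs_cylAvg_sub_div f hs, ← mul_div_assoc]
  exact mul_le_mul_of_nonneg_left (hΦ _ (by positivity)) ENNReal.toReal_nonneg

end Cylinders

/-- Along level `x`, the factor `log(e + e^{εx} a)` is at most of order `x`, and it is at least of
order `x` unless `a < e^{-εδx}`. -/
lemma exists_log_comparable {ε δ κ D : ℝ} (hε : 0 < ε) (hδ : δ < 1) (hκ : 1 ≤ κ) (hD : 0 ≤ D) :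
    ∃ A : ℝ, 1 ≤ A ∧ ∀ x a : ℝ, 1 ≤ x → 0 ≤ a → a ≤ 2 * D * κ ^ x →
      Real.log (Real.exp 1 + Real.exp (ε * x) * a) ≤ A * x ∧
      (Real.exp (-(ε * δ * x)) ≤ a →
        x ≤ A * Real.log (Real.exp 1 + Real.exp (ε * x) * a)) := by
  have hc : 0 < ε * (1 - δ) := mul_pos hε (by linarith)
  have hlD : 0 ≤ Real.log (1 + 2 * D) := Real.log_nonneg (by linarith)
  have hlκ : 0 ≤ Real.log κ := Real.log_nonneg hκ
  have hκ0 : 0 < κ := by linarith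
  have hinv : 0 ≤ 1 / (ε * (1 - δ)) := by positivity
  refine ⟨1 + Real.log (1 + 2 * D) + ε + Real.log κ + 1 / (ε * (1 - δ)), by linarith,
    fun x a hx ha haD => ⟨?_, fun hax => ?_⟩⟩
  · have hexp : 1 ≤ Real.exp (ε * x) := Real.one_le_exp (by positivity)
    have hκx : 1 ≤ κ ^ x := Real.one_le_rpow hκ (by linarith)
    have hprod : 1 ≤ Real.exp (ε * x) * κ ^ x := one_le_mul_of_one_le_of_one_le hexp hκx
    have he : 1 ≤ Real.exp 1 := Real.one_le_exp zero_le_one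
    have hle : Real.exp 1 + Real.exp (ε * x) * a ≤
        Real.exp 1 * (1 + 2 * D) * (Real.exp (ε * x) * κ ^ x) := by
      have h1 : Real.exp 1 ≤ Real.exp 1 * (Real.exp (ε * x) * κ ^ x) :=
        le_mul_of_one_le_right (by linarith) hprod
      have h2 : Real.exp (ε * x) * a ≤ Real.exp (ε * x) * (2 * D * κ ^ x) := by gcongr
      have h3 : Real.exp (ε * x) * (2 * D * κ ^ x) ≤
          Real.exp 1 * (Real.exp (ε * x) * (2 * D * κ ^ x)) :=
        le_mul_of_one_le_left (by positivity) he
      linarith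
    have hlog := Real.log_le_log (by positivity) hle
    rw [Real.log_mul (by positivity) (by positivity), Real.log_mul (by positivity) (by positivity),
      Real.log_mul (by positivity) (by positivity), Real.log_exp, Real.log_exp,
      Real.log_rpow hκ0] at hlog
    have h4 : 1 + Real.log (1 + 2 * D) ≤ (1 + Real.log (1 + 2 * D)) * x :=
      le_mul_of_one_le_right (by linarith) hx
    have h5 : 0 ≤ 1 / (ε * (1 - δ)) * x := by positivity
    linarith
  · have hL : ε * (1 - δ) * x ≤ Real.log (Real.exp 1 + Real.exp (ε * x) * a) := by
      rw [Real.le_log_iff_exp_le (by positivity)]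
      calc Real.exp (ε * (1 - δ) * x) = Real.exp (ε * x) * Real.exp (-(ε * δ * x)) := by
            rw [← Real.exp_add]
            ring_nf
        _ ≤ Real.exp (ε * x) * a := by gcongr
        _ ≤ _ := by linarith [Real.exp_pos 1]
    have hL1 := one_le_log_exp_one_add (t := Real.exp (ε * x) * a) (by positivity)
    calc x = 1 / (ε * (1 - δ)) * (ε * (1 - δ) * x) := by
            rw [← mul_assoc, one_div_mul_cancel hc.ne', one_mul]
      _ ≤ 1 / (ε * (1 - δ)) * Real.log (Real.exp 1 + Real.exp (ε * x) * a) := by gcongr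
      _ ≤ _ := by
        gcongr
        linarith

lemma exists_rpow_log_comparable {ε δ κ D p : ℝ} (hε : 0 < ε) (hδ : δ < 1) (hκ : 1 ≤ κ)
    (hD : 0 ≤ D) (hp : 0 ≤ p) (l : ℝ) :
    ∃ A : ℝ, 1 ≤ A ∧ ∀ x a : ℝ, 1 ≤ x → 0 ≤ a → a ≤ 2 * D * κ ^ x →
      a ^ p * Real.log (Real.exp 1 + Real.exp (ε * x) * a) ^ l ≤
        A * (x ^ l * a ^ p + x ^ |l| * Real.exp (-(ε * δ * x)) ^ p) ∧
      x ^ l * a ^ p ≤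
        A * (a ^ p * Real.log (Real.exp 1 + Real.exp (ε * x) * a) ^ l +
          x ^ |l| * Real.exp (-(ε * δ * x)) ^ p) := by
  obtain ⟨A, hA, h⟩ := exists_log_comparable hε hδ hκ hD
  have hA' : 1 ≤ A ^ |l| := Real.one_le_rpow hA (abs_nonneg l)
  refine ⟨A ^ |l|, hA', fun x a hx ha haD => ?_⟩
  obtain ⟨h1, h2⟩ := h x a hx ha haD
  have hL := one_le_log_exp_one_add (t := Real.exp (ε * x) * a) (by positivity)
  set L := Real.log (Real.exp 1 + Real.exp (ε * x) * a)
  have hx0 : 0 < x := by linarith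
  have hL0 : 0 < L := by linarith
  have hap : 0 ≤ a ^ p := Real.rpow_nonneg ha p
  have hxl : 0 < x ^ l := Real.rpow_pos_of_pos hx0 l
  have hLl : 0 < L ^ l := Real.rpow_pos_of_pos hL0 l
  have hr : 0 ≤ x ^ |l| * Real.exp (-(ε * δ * x)) ^ p := by positivity
  rcases le_total (Real.exp (-(ε * δ * x))) a with hax | hax
  · have h3 := rpow_le_rpow_abs_mul hA hL0 hx0 h1 (h2 hax) l
    have h4 := rpow_le_rpow_abs_mul hA hx0 hL0 (h2 hax) h1 l
    constructor
    · calc a ^ p * L ^ l ≤ a ^ p * (A ^ |l| * x ^ l) := by gcongr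
        _ = A ^ |l| * (x ^ l * a ^ p + 0) := by ring
        _ ≤ _ := by gcongr
    · calc x ^ l * a ^ p ≤ A ^ |l| * L ^ l * a ^ p := by gcongr
        _ = A ^ |l| * (a ^ p * L ^ l + 0) := by ring
        _ ≤ _ := by gcongr
  · have hae : a ^ p ≤ Real.exp (-(ε * δ * x)) ^ p := Real.rpow_le_rpow ha hax hp
    constructor
    · calc a ^ p * L ^ l ≤ Real.exp (-(ε * δ * x)) ^ p * (A ^ |l| * x ^ |l|) := by
            refine mul_le_mul hae ?_ hLl.le (by positivity)
            rw [← Real.mul_rpow (by linarith) hx0.le]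
            exact (Real.rpow_le_rpow_of_exponent_le hL (le_abs_self l)).trans
              (Real.rpow_le_rpow hL0.le h1 (abs_nonneg l))
        _ = A ^ |l| * (0 + x ^ |l| * Real.exp (-(ε * δ * x)) ^ p) := by ring
        _ ≤ _ := by gcongr; positivity
    · calc x ^ l * a ^ p ≤ x ^ |l| * Real.exp (-(ε * δ * x)) ^ p := by
            refine mul_le_mul ?_ hae hap (by positivity)
            exact Real.rpow_le_rpow_of_exponent_le hx (le_abs_self l)
        _ ≤ A ^ |l| * (0 + x ^ |l| * Real.exp (-(ε * δ * x)) ^ p) := by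
            rw [zero_add]
            exact le_mul_of_one_le_left hr hA'
        _ ≤ _ := by gcongr; positivity

lemma summable_exp_neg_mul_rpow {c : ℝ} (hc : 0 < c) (s : ℝ) :
    Summable fun n : ℕ => Real.exp (-(c * ((n : ℝ) + 1))) * ((n : ℝ) + 1) ^ s := by
  have h := (_root_.summable_nat_add_iff 1).2 (Real.summable_pow_mul_exp_neg_nat_mul ⌈s⌉₊ hc)
  refine Summable.of_nonneg_of_le (fun n => by positivity) (fun n => ?_) h
  push_cast
  rw [mul_comm, neg_mul]
  gcongr
  rw [← Real.rpow_natCast]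
  exact Real.rpow_le_rpow_of_exponent_le (by linarith [n.cast_nonneg (α := ℝ)]) (Nat.le_ceil s)

section Energies

variable {K : ℕ} {ν : Measure (Bd K)}

lemma tsum_weighted_sum_le (hK : K ≠ 0)
    (hν : ∀ (n : ℕ) (w : Fin n → Fin K), ν (cyl w) = ((K : ℝ≥0∞) ^ n)⁻¹)
    {ε θ δ p s r A : ℝ} (hA : 0 ≤ A) {F G : ∀ n : ℕ, (Fin (n + 1) → Fin K) → ℝ}
    (hG : ∀ n w, 0 ≤ G n w)
    (hFG : ∀ n w, F n w ≤
      A * (G n w + ((n : ℝ) + 1) ^ r * Real.exp (-(ε * δ * ((n : ℝ) + 1))) ^ p)) :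
    ∑' n : ℕ, ENNReal.ofReal (Real.exp (ε * ((n : ℝ) + 1) * θ * p) * ((n : ℝ) + 1) ^ s *
        ∑ w : Fin (n + 1) → Fin K, (ν (cyl w)).toReal * F n w) ≤
      ENNReal.ofReal A * (∑' n : ℕ, ENNReal.ofReal (Real.exp (ε * ((n : ℝ) + 1) * θ * p) *
        ((n : ℝ) + 1) ^ s * ∑ w : Fin (n + 1) → Fin K, (ν (cyl w)).toReal * G n w) +
        ∑' n : ℕ, ENNReal.ofReal (Real.exp (-(ε * p * (δ - θ) * ((n : ℝ) + 1))) *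
          ((n : ℝ) + 1) ^ (s + r))) := by
  rw [← ENNReal.tsum_add, ← ENNReal.tsum_mul_left]
  refine ENNReal.tsum_le_tsum fun n => ?_
  have hx : (0 : ℝ) < (n : ℝ) + 1 := by positivity
  have hsum : 0 ≤ ∑ w : Fin (n + 1) → Fin K, (ν (cyl w)).toReal * G n w :=
    Finset.sum_nonneg fun w _ => mul_nonneg ENNReal.toReal_nonneg (hG n w)
  rw [← ENNReal.ofReal_add (by positivity) (by positivity), ← ENNReal.ofReal_mul hA]
  refine ENNReal.ofReal_le_ofReal ?_
  set x : ℝ := (n : ℝ) + 1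
  have hexp : Real.exp (-(ε * p * (δ - θ) * x)) =
      Real.exp (ε * x * θ * p) * Real.exp (-(ε * δ * x)) ^ p := by
    rw [← Real.exp_mul, ← Real.exp_add]
    ring_nf
  rw [hexp, Real.rpow_add hx]
  calc Real.exp (ε * x * θ * p) * x ^ s *
        ∑ w : Fin (n + 1) → Fin K, (ν (cyl w)).toReal * F n w
      ≤ Real.exp (ε * x * θ * p) * x ^ s * ∑ w : Fin (n + 1) → Fin K, (ν (cyl w)).toReal *
          (A * (G n w + x ^ r * Real.exp (-(ε * δ * x)) ^ p)) := by
        gcongr with w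
        exact hFG n w
    _ = Real.exp (ε * x * θ * p) * x ^ s *
          (A * (∑ w : Fin (n + 1) → Fin K, (ν (cyl w)).toReal * G n w +
            (∑ w : Fin (n + 1) → Fin K, (ν (cyl w)).toReal) *
              (x ^ r * Real.exp (-(ε * δ * x)) ^ p))) := by
        rw [Finset.sum_mul, ← Finset.sum_add_distrib, Finset.mul_sum _ _ A]
        congr 1
        refine Finset.sum_congr rfl fun w _ => ?_
        ring
    _ = _ := by
        rw [sum_measure_cyl hK hν]
        ring

lemma besovEnergy_eq (ε θ p lam1 lam2 : ℝ) (f : Bd K → ℝ) :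
    besovEnergy ν ε θ p (lam1 + lam2) f =
      ∑' n : ℕ, ENNReal.ofReal (Real.exp (ε * ((n : ℝ) + 1) * θ * p) * ((n : ℝ) + 1) ^ lam2 *
        ∑ w : Fin (n + 1) → Fin K, (ν (cyl w)).toReal * (((n : ℝ) + 1) ^ lam1 *
          |cylAvg ν f w - cylAvg ν f (Fin.init w)| ^ p)) := by
  unfold besovEnergy
  refine tsum_congr fun n => ?_
  congr 1
  rw [Real.rpow_add (by positivity), Finset.mul_sum, Finset.mul_sum]
  refine Finset.sum_congr rfl fun w _ => ?_
  ring

lemma orliczEnergy_eq (ε θ p lam1 lam2 : ℝ) (f : Bd K → ℝ) :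
    orliczEnergy ν (Phi p lam1) ε θ p lam2 f =
      ∑' n : ℕ, ENNReal.ofReal (Real.exp (ε * ((n : ℝ) + 1) * θ * p) * ((n : ℝ) + 1) ^ lam2 *
        ∑ w : Fin (n + 1) → Fin K, (ν (cyl w)).toReal *
          (|cylAvg ν f w - cylAvg ν f (Fin.init w)| ^ p * Real.log (Real.exp 1 +
            Real.exp (ε * ((n : ℝ) + 1)) * |cylAvg ν f w - cylAvg ν f (Fin.init w)|) ^ lam1)) := by
  unfold orliczEnergy Phi
  refine tsum_congr fun n => ?_
  congr 1
  have hexp : Real.exp (ε * ((n : ℝ) + 1) * θ * p) =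
      Real.exp (ε * ((n : ℝ) + 1) * (θ - 1) * p) * Real.exp (ε * ((n : ℝ) + 1)) ^ p := by
    rw [← Real.exp_mul, ← Real.exp_add]
    ring_nf
  rw [hexp, Finset.mul_sum, Finset.mul_sum]
  refine Finset.sum_congr rfl fun w _ => ?_
  rw [Real.mul_rpow (Real.exp_pos _).le (abs_nonneg _)]
  ring

/-- On functions with `L¹` norm at most `D`, the two energies control each other up to an additive
constant. -/
lemma exists_energy_comparable (hK : 1 ≤ K)
    (hν : ∀ (n : ℕ) (w : Fin n → Fin K), ν (cyl w) = ((K : ℝ≥0∞) ^ n)⁻¹)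
    {ε θ p D : ℝ} (hε : 0 < ε) (hθ : θ < 1) (hp : 0 < p) (hD : 0 ≤ D) (lam1 lam2 : ℝ) :
    ∃ A T : ℝ≥0, ∀ f : Bd K → ℝ, ∫⁻ x, ‖f x‖ₑ ∂ν ≤ ENNReal.ofReal D →
      orliczEnergy ν (Phi p lam1) ε θ p lam2 f ≤
        A * (besovEnergy ν ε θ p (lam1 + lam2) f + T) ∧
      besovEnergy ν ε θ p (lam1 + lam2) f ≤
        A * (orliczEnergy ν (Phi p lam1) ε θ p lam2 f + T) := by
  obtain ⟨δ, hθδ, hδ⟩ := exists_between hθ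
  have hK0 : K ≠ 0 := by omega
  obtain ⟨A, hA, h⟩ := exists_rpow_log_comparable hε hδ
    (by exact_mod_cast hK : (1 : ℝ) ≤ (K : ℝ)) hD hp.le lam1
  have hA0 : 0 ≤ A := by linarith
  have hsum := summable_exp_neg_mul_rpow (c := ε * p * (δ - θ))
    (mul_pos (mul_pos hε hp) (by linarith)) (lam2 + |lam1|)
  refine ⟨A.toNNReal, (∑' n : ℕ, Real.exp (-(ε * p * (δ - θ) * ((n : ℝ) + 1))) *
    ((n : ℝ) + 1) ^ (lam2 + |lam1|)).toNNReal, fun f hf => ?_⟩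
  have hT : ((∑' n : ℕ, Real.exp (-(ε * p * (δ - θ) * ((n : ℝ) + 1))) *
      ((n : ℝ) + 1) ^ (lam2 + |lam1|)).toNNReal : ℝ≥0∞) =
      ∑' n : ℕ, ENNReal.ofReal (Real.exp (-(ε * p * (δ - θ) * ((n : ℝ) + 1))) *
        ((n : ℝ) + 1) ^ (lam2 + |lam1|)) :=
    ENNReal.ofReal_tsum_of_nonneg (fun n => by positivity) hsum
  have hcmp (n : ℕ) (w : Fin (n + 1) → Fin K) := h ((n : ℝ) + 1) _
    (by linarith [n.cast_nonneg (α := ℝ)]) (abs_nonneg _) (abs_cylAvg_sub_init_le hK hν hD hf w)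
  rw [hT, besovEnergy_eq, orliczEnergy_eq]
  refine ⟨tsum_weighted_sum_le hK0 hν hA0 (fun n w => by positivity) fun n w => (hcmp n w).1,
    tsum_weighted_sum_le hK0 hν hA0 (fun n w => ?_) fun n w => (hcmp n w).2⟩
  exact mul_nonneg (by positivity)
    (Real.rpow_nonneg (zero_le_one.trans (one_le_log_exp_one_add (by positivity))) _)

lemma exists_orliczSemi_le [IsProbabilityMeasure ν] (hK : 1 ≤ K)
    (hν : ∀ (n : ℕ) (w : Fin n → Fin K), ν (cyl w) = ((K : ℝ≥0∞) ^ n)⁻¹)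
    {ε θ p lam1 : ℝ} (hε : 0 < ε) (hθ : θ < 1) (hp : 1 < p ∨ (p = 1 ∧ 0 ≤ lam1)) (lam2 : ℝ) :
    ∃ C : ℝ≥0, 1 ≤ C ∧ ∀ (f : Bd K → ℝ) (M : ℝ≥0), luxNorm ν (Phi p lam1) f < M →
      besovEnergy ν ε θ p (lam1 + lam2) f ^ (1 / p) < M →
      orliczSemi ν (Phi p lam1) ε θ p lam2 f ≤ C * M := by
  have hp1 : 1 ≤ p := hp.elim le_of_lt fun h => h.1.ge
  have hp0 : 0 < p := by linarith
  obtain ⟨C, hC, hPhi⟩ := exists_le_one_add_Phi hp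
  obtain ⟨A, T, h⟩ := exists_energy_comparable hK hν hε hθ hp0 (D := 1 + C) (by linarith) lam1 lam2
  obtain ⟨B, hB, hdiv⟩ := exists_Phi_div_le hp1 lam1
  have hB0 : 0 ≤ B := by linarith
  obtain ⟨s, hs, hs1⟩ := exists_one_le_mul_rpow_neg_half_le_one (B := B) (A * (1 + T)) hB0
    (by finiteness)
  refine ⟨s, hs, fun f M hlux hbes => ?_⟩
  have hM : 0 < M := by exact_mod_cast (zero_le (a := luxNorm ν (Phi p lam1) f)).trans_lt hlux
  have hs0 : 0 < s := by positivity
  have hL1 := lintegral_ofReal_abs_div_le (by linarith) hPhi (fun t => Phi_nonneg p lam1) hlux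
  have hb : besovEnergy ν ε θ p (lam1 + lam2) (fun x => f x / M) ≤ 1 := by
    rw [besovEnergy_div _ _ _ _ (NNReal.coe_pos.2 hM)]
    have h1 : besovEnergy ν ε θ p (lam1 + lam2) f ≤ (M : ℝ≥0∞) ^ p := by
      rw [one_div] at hbes
      exact (ENNReal.rpow_inv_le_iff hp0).1 hbes.le
    rw [Real.rpow_neg M.coe_nonneg, ENNReal.ofReal_inv_of_pos (by positivity),
      ← ENNReal.ofReal_rpow_of_pos (by positivity), ENNReal.ofReal_coe_nnreal]
    calc _ ≤ ((M : ℝ≥0∞) ^ p)⁻¹ * (M : ℝ≥0∞) ^ p := by gcongr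
      _ ≤ 1 := ENNReal.inv_mul_le_one _
  have ho := (h _ hL1).1
  have hdiv' := orliczEnergy_div_le (ν := ν) ε θ p lam2 s.coe_nonneg (by positivity)
    (fun t ht => hdiv s t (by exact_mod_cast hs) ht) (fun x => f x / M)
  refine (iInf₂_le_of_le (s * M) (mul_pos hs0 hM) (iInf_le_of_le ?_ le_rfl)).trans
    (ENNReal.coe_mul s M).le
  simp only [div_div, ← NNReal.coe_mul, mul_comm M s] at hdiv'
  refine hdiv'.trans (le_trans ?_ hs1)
  gcongr
  exact ho.trans (by gcongr)

lemma exists_besovEnergy_rpow_le [IsProbabilityMeasure ν] (hK : 1 ≤ K)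
    (hν : ∀ (n : ℕ) (w : Fin n → Fin K), ν (cyl w) = ((K : ℝ≥0∞) ^ n)⁻¹)
    {ε θ p lam1 : ℝ} (hε : 0 < ε) (hθ : θ < 1) (hp : 1 < p ∨ (p = 1 ∧ 0 ≤ lam1)) (lam2 : ℝ) :
    ∃ C : ℝ≥0, 1 ≤ C ∧ ∀ (f : Bd K → ℝ) (M : ℝ≥0), luxNorm ν (Phi p lam1) f < M →
      orliczSemi ν (Phi p lam1) ε θ p lam2 f < M →
      besovEnergy ν ε θ p (lam1 + lam2) f ^ (1 / p) ≤ C * M := by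
  have hp1 : 1 ≤ p := hp.elim le_of_lt fun h => h.1.ge
  have hp0 : 0 < p := by linarith
  obtain ⟨C, hC, hPhi⟩ := exists_le_one_add_Phi hp
  obtain ⟨A, T, h⟩ := exists_energy_comparable hK hν hε hθ hp0 (D := 1 + C) (by linarith) lam1 lam2
  obtain ⟨B, hB, hdiv⟩ := exists_Phi_div_le hp1 lam1
  have hB0 : 0 ≤ B := by linarith
  refine ⟨max 1 ((A * (B.toNNReal + T)) ^ (1 / p)), le_max_left _ _, fun f M hlux horl => ?_⟩
  have hM : 0 < M := by exact_mod_cast (zero_le (a := luxNorm ν (Phi p lam1) f)).trans_lt hlux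
  have hL1 := lintegral_ofReal_abs_div_le (by linarith) hPhi (fun t => Phi_nonneg p lam1) hlux
  unfold orliczSemi at horl
  simp only [iInf_lt_iff] at horl
  obtain ⟨k, hk, hkE, hkM⟩ := horl
  have hkM' : (k : ℝ) ≤ M := by exact_mod_cast hkM.le
  have hk' : (0 : ℝ) < k := hk
  have hs : (1 : ℝ) ≤ M / k := (one_le_div hk').2 hkM'
  have hE : orliczEnergy ν (Phi p lam1) ε θ p lam2 (fun x => f x / M) ≤ B.toNNReal := by
    have hdiv' := orliczEnergy_div_le (ν := ν) ε θ p lam2 (by linarith) (by positivity)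
      (fun t ht => hdiv (M / k) t hs ht) (fun x => f x / k)
    have hfun : (fun x => f x / (k : ℝ) / ((M : ℝ) / k)) = fun x => f x / M := by
      funext x
      field_simp
    rw [hfun] at hdiv'
    calc _ ≤ _ := hdiv'
      _ ≤ ENNReal.ofReal B * 1 := by
        gcongr
        exact mul_le_of_le_one_right hB0 (Real.rpow_le_one_of_one_le_of_nonpos hs (by norm_num))
      _ = B.toNNReal := mul_one _
  have hb := (h _ hL1).2
  rw [besovEnergy_div _ _ _ _ (NNReal.coe_pos.2 hM), Real.rpow_neg M.coe_nonneg,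
    ENNReal.ofReal_inv_of_pos (by positivity), ← ENNReal.ofReal_rpow_of_pos (by positivity),
    ENNReal.ofReal_coe_nnreal, mul_comm, ← div_eq_mul_inv] at hb
  have hMp : (M : ℝ≥0∞) ^ p ≠ 0 := by simp [hM.ne']
  rw [ENNReal.div_le_iff hMp (by finiteness)] at hb
  calc besovEnergy ν ε θ p (lam1 + lam2) f ^ (1 / p)
      ≤ (A * (B.toNNReal + T) * (M : ℝ≥0∞) ^ p) ^ (1 / p) := by
        gcongr
        exact hb.trans (by gcongr)
    _ = ((A * (B.toNNReal + T)) ^ (1 / p) : ℝ≥0∞) * M := by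
        rw [ENNReal.mul_rpow_of_nonneg _ _ (by positivity), ← ENNReal.rpow_mul,
          mul_one_div_cancel hp0.ne', ENNReal.rpow_one]
    _ = (((A * (B.toNNReal + T)) ^ (1 / p) : ℝ≥0) : ℝ≥0∞) * M := by
        rw [ENNReal.coe_rpow_of_nonneg _ (by positivity)]
        push_cast
        rfl
    _ ≤ _ := by
        gcongr
        exact le_max_right _ _

end Energies

lemma ENNReal.le_mul_add_of_forall_lt {a b c : ℝ≥0∞} {C : ℝ≥0} (hC : 1 ≤ C) (ha : a < ⊤)
    (hb : b < ⊤) (h : ∀ M : ℝ≥0, a < M → b < M → c ≤ C * M) : c ≤ C * (a + b) := by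
  lift a to ℝ≥0 using ha.ne
  lift b to ℝ≥0 using hb.ne
  have hC0 : 0 < C := by positivity
  refine ENNReal.le_of_forall_pos_le_add fun e he _ => ?_
  have hd : 0 < e / C := div_pos he hC0
  refine (h (a + b + e / C) ?_ ?_).trans (le_of_eq ?_)
  · norm_cast
    exact lt_add_of_le_of_pos le_self_add hd
  · norm_cast
    exact lt_add_of_le_of_pos le_add_self hd
  · norm_cast
    rw [mul_add, mul_div_cancel₀ _ hC0.ne']

/-- The sets `{f ∈ L^Φ(ν) : ‖f‖_{Ḃ^{θ,λ}_p} < ∞}` and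
`{f ∈ L^Φ(ν) : inf{k > 0 : |f/k|_{Ḃ^{θ,λ₂}_Φ} ≤ 1} < ∞}` coincide, and the corresponding
norms `‖f‖_{L^Φ} + ‖f‖_{Ḃ^{θ,λ}_p}` and `‖f‖_{L^Φ} + inf{k > 0 : |f/k|_{Ḃ^{θ,λ₂}_Φ} ≤ 1}`
are comparable, where `Φ(t) = t^p log^{λ₁}(e+t)`, `λ₁ + λ₂ = λ`, `0 < θ < 1`, and either
`p > 1` or `p = 1, λ₁ ≥ 0`. -/
theorem statement4 (K : ℕ) (hK : 2 ≤ K) (ε : ℝ) (hε : 0 < ε)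
    (ν : Measure (Bd K)) (hprob : IsProbabilityMeasure ν)
    (hν : ∀ (n : ℕ) (w : Fin n → Fin K), ν (cyl w) = ((K : ℝ≥0∞) ^ n)⁻¹)
    (p lam lam1 lam2 θ : ℝ) (hp : 1 < p ∨ (p = 1 ∧ 0 ≤ lam1))
    (hlam : lam1 + lam2 = lam) (hθ0 : 0 < θ) (hθ1 : θ < 1) :
    ∃ C : ℝ≥0, 1 ≤ C ∧
      ∀ f : Bd K → ℝ,
        ((MemLPhi ν (Phi p lam1) f ∧ besovEnergy ν ε θ p lam f ^ (1 / p) < ⊤) ↔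
          (MemLPhi ν (Phi p lam1) f ∧ orliczSemi ν (Phi p lam1) ε θ p lam2 f < ⊤)) ∧
        ((MemLPhi ν (Phi p lam1) f ∧ besovEnergy ν ε θ p lam f ^ (1 / p) < ⊤) →
          ((C : ℝ≥0∞)⁻¹ *
              (luxNorm ν (Phi p lam1) f + besovEnergy ν ε θ p lam f ^ (1 / p)) ≤
            luxNorm ν (Phi p lam1) f + orliczSemi ν (Phi p lam1) ε θ p lam2 f ∧
          luxNorm ν (Phi p lam1) f + orliczSemi ν (Phi p lam1) ε θ p lam2 f ≤
            (C : ℝ≥0∞) *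
              (luxNorm ν (Phi p lam1) f + besovEnergy ν ε θ p lam f ^ (1 / p)))) := by
  subst hlam
  have hK1 : 1 ≤ K := by omega
  have hp1 : 1 ≤ p := hp.elim le_of_lt fun h => h.1.ge
  obtain ⟨C₁, hC₁, h₁⟩ := exists_orliczSemi_le hK1 hν hε hθ1 hp lam2
  obtain ⟨C₂, hC₂, h₂⟩ := exists_besovEnergy_rpow_le hK1 hν hε hθ1 hp lam2
  refine ⟨1 + C₁ + C₂, (le_self_add.trans le_self_add), fun f => ?_⟩
  have hlux := luxNorm_lt_top_of_memLPhi (μ := ν) hp1 (l := lam1) (u := f)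
  have horl (hf : MemLPhi ν (Phi p lam1) f)
      (hb : besovEnergy ν ε θ p (lam1 + lam2) f ^ (1 / p) < ⊤) :=
    ENNReal.le_mul_add_of_forall_lt hC₁ (hlux hf) hb (h₁ f)
  have hbes (hf : MemLPhi ν (Phi p lam1) f) (ho : orliczSemi ν (Phi p lam1) ε θ p lam2 f < ⊤) :=
    ENNReal.le_mul_add_of_forall_lt hC₂ (hlux hf) ho (h₂ f)
  have hfin (hf : MemLPhi ν (Phi p lam1) f)
      (hb : besovEnergy ν ε θ p (lam1 + lam2) f ^ (1 / p) < ⊤) :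
      orliczSemi ν (Phi p lam1) ε θ p lam2 f < ⊤ :=
    (horl hf hb).trans_lt
      (ENNReal.mul_lt_top ENNReal.coe_lt_top (ENNReal.add_lt_top.2 ⟨hlux hf, hb⟩))
  refine ⟨⟨fun ⟨hf, hb⟩ => ⟨hf, hfin hf hb⟩, fun ⟨hf, ho⟩ => ⟨hf, (hbes hf ho).trans_lt
    (ENNReal.mul_lt_top ENNReal.coe_lt_top (ENNReal.add_lt_top.2 ⟨hlux hf, ho⟩))⟩⟩, ?_⟩
  rintro ⟨hf, hb⟩
  have ho := hfin hf hb
  have hmain {a b c : ℝ≥0∞} {D : ℝ≥0} (hD : 1 + D ≤ 1 + C₁ + C₂) (h : c ≤ D * (a + b)) :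
      a + c ≤ ((1 + C₁ + C₂ : ℝ≥0) : ℝ≥0∞) * (a + b) :=
    calc a + c ≤ (a + b) + D * (a + b) := add_le_add le_self_add h
      _ = ((1 + D : ℝ≥0) : ℝ≥0∞) * (a + b) := by push_cast; ring
      _ ≤ _ := by gcongr
  constructor
  · rw [mul_comm, ← div_eq_mul_inv]
    refine ENNReal.div_le_of_le_mul' (hmain ?_ (hbes hf ho))
    rw [add_right_comm]
    exact le_self_add
  · exact hmain le_self_add (horl hf hb)
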